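/- Let N(h,k) and D(h,k) be complex power series in two variables convergent in a neighborhood of (0,0), both symmetric (N(h,k)=N(k,h), D(h,k)=D(k,h)), with D(0,0)=0 and ∂_h D(0,0) = ∂_k D(0,0) ≠ 0. Then there exists a unique pair of convergent power series Q(h,k) (symmetric in h,k) and J(r) (in one variable) such that N(h,k) = Q(h,k)·D(h,k) + J(hk) as convergent power series in a neighborhood of the origin. -/

import Mathlib

open Filter
open scoped Topology NNReal

section Hadamard

variable {𝕜 E F : Type*} [NontriviallyNormedField 𝕜] [NormedAddCommGroup E] [NormedSpace 𝕜 E]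
  [NormedAddCommGroup F] [NormedSpace 𝕜 F]

/-- Telescoping expansion of `f (v, …, v) - f (π v, …, π v)` when `v - π v` lies on a line. -/
theorem ContinuousMultilinearMap.sub_comp_eq_smul_sum_curryMid {n : ℕ}
    (f : ContinuousMultilinearMap 𝕜 (fun _ : Fin (n + 1) => E) F) (π : E →L[𝕜] E)
    (ℓ : E →L[𝕜] 𝕜) (e : E)
    (hπ : ∀ v, v - π v = ℓ v • e) (v : E) :
    f (fun _ => v) - f (fun _ => π v) =
      ℓ v • ∑ i : Fin (n + 1), (f.curryMid i e).compContinuousLinearMap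
        (fun j => if j.castSucc < i then ContinuousLinearMap.id 𝕜 E else π) (fun _ => v) := by
  let a : ℕ → F := fun k => f fun j => if (j : ℕ) < k then v else π v
  have key : ∀ i : Fin (n + 1), a (i + 1) - a i = ℓ v • (f.curryMid i e).compContinuousLinearMap
        (fun j => if j.castSucc < i then ContinuousLinearMap.id 𝕜 E else π) (fun _ => v) := by
    intro i
    set m : Fin n → E := fun j => (if j.castSucc < i then ContinuousLinearMap.id 𝕜 E else π) v
      with hm
    have h1 : ∀ k : ℕ, k = i ∨ k = i + 1 →
        (fun j : Fin (n + 1) => if (j : ℕ) < k then v else π v) =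
          i.insertNth (if (i : ℕ) < k then v else π v) m := by
      intro k hk
      refine Fin.eq_insertNth_iff.2 ⟨rfl, ?_⟩
      funext j
      by_cases hj : j.castSucc < i
      · have : (j : ℕ) < i := hj
        have h2 : (j : ℕ) < k := by omega
        simp [hm, Fin.removeNth, Fin.succAbove_of_castSucc_lt _ _ hj, hj, h2]
      · have h2 : ¬ (j : ℕ) < i := hj
        have : ¬ (j.succ : ℕ) < k := by simp; omega
        simp only [hm, Fin.removeNth, Fin.succAbove_of_le_castSucc _ _ (not_lt.1 hj), this, hj,
          if_false]
    have h2 : ∀ x : E, (i.insertNth x m : Fin (n + 1) → E) =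
        Function.update (i.insertNth e m : Fin (n + 1) → E) i x := by
      intro x; simp
    simp only [a]
    rw [h1 _ (Or.inr rfl), h1 _ (Or.inl rfl)]
    simp only [lt_add_iff_pos_right, zero_lt_one, lt_irrefl, if_true, if_false]
    rw [h2 v, h2 (π v), ← f.map_update_sub, hπ, f.map_update_smul, ← h2]
    simp [hm]
  rw [Finset.smul_sum, ← Finset.sum_congr rfl (fun i _ => key i),
    Fin.sum_univ_eq_sum_range (fun i => a (i + 1) - a i), Finset.sum_range_sub]
  have h3 : ∀ j : Fin (n + 1), (j : ℕ) < n + 1 := fun j => j.2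
  simp only [a, h3, if_true, Nat.not_lt_zero, if_false]

/-- An analytic germ `f` is congruent to `f ∘ π` modulo `ℓ`, when `π` projects along a line whose
coordinate is `ℓ`. -/
theorem AnalyticAt.exists_analyticAt_sub_comp_eq_smul [CompleteSpace F] {f : E → F}
    (hf : AnalyticAt 𝕜 f 0) (π : E →L[𝕜] E) (hπ1 : ‖π‖ ≤ 1) (ℓ : E →L[𝕜] 𝕜) (e : E)
    (hπ : ∀ v, v - π v = ℓ v • e) :
    ∃ q : E → F, AnalyticAt 𝕜 q 0 ∧ ∀ᶠ v in 𝓝 0, f v - f (π v) = ℓ v • q v := by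
  obtain ⟨p, R, hp⟩ := hf
  let q : FormalMultilinearSeries 𝕜 E F := fun n => ∑ i : Fin (n + 1),
    ((p (n + 1)).curryMid i e).compContinuousLinearMap
      (fun j => if j.castSucc < i then ContinuousLinearMap.id 𝕜 E else π)
  have hq : ∀ n v, p (n + 1) (fun _ => v) - p (n + 1) (fun _ => π v) =
      ℓ v • q n (fun _ => v) := fun n v => by
    rw [(p (n + 1)).sub_comp_eq_smul_sum_curryMid π ℓ e hπ v]
    simp [q]
  have hqnorm : ∀ n, ‖q n‖ ≤ (n + 1) * (‖p (n + 1)‖ * ‖e‖) := fun n => by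
    refine (norm_sum_le _ _).trans ?_
    refine (Finset.sum_le_card_nsmul _ _ (‖p (n + 1)‖ * ‖e‖) fun i _ => ?_).trans
      (by simp)
    refine (ContinuousMultilinearMap.norm_compContinuousLinearMap_le _ _).trans ?_
    refine (mul_le_of_le_one_right (norm_nonneg _)
      (Finset.prod_le_one (fun _ _ => norm_nonneg _) fun j _ => ?_)).trans ?_
    · split_ifs
      · exact ContinuousLinearMap.norm_id_le
      · exact hπ1
    · exact (ContinuousLinearMap.le_opNorm _ _).trans_eq (by rw [(p (n + 1)).norm_curryMid i])
  obtain ⟨r, hr0, hr⟩ : ∃ r : ℝ≥0, 0 < r ∧ (r : ENNReal) < p.radius := by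
    obtain ⟨r, h0, h1⟩ := ENNReal.lt_iff_exists_nnreal_btwn.1 (hp.r_pos.trans_le hp.r_le)
    exact ⟨r, by simpa using h0, h1⟩
  obtain ⟨C, hC, hpC⟩ := p.norm_mul_pow_le_of_lt_radius hr
  have hqrad : 0 < q.radius := by
    refine lt_of_lt_of_le (b := ((r / 2 : ℝ≥0) : ENNReal)) (by simpa using hr0.ne')
      (q.le_radius_of_bound (C * ‖e‖ / r) fun n => ?_)
    have hr0' : (0 : ℝ) < r := hr0
    have h2 : ((n : ℝ) + 1) ≤ 2 ^ n := by exact_mod_cast Nat.lt_two_pow_self (n := n)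
    calc ‖q n‖ * ((r / 2 : ℝ≥0) : ℝ) ^ n
        ≤ (2 ^ n * (‖p (n + 1)‖ * ‖e‖)) * ((r : ℝ) / 2) ^ n := by
          push_cast
          gcongr
          exact (hqnorm n).trans (by gcongr)
      _ = (‖p (n + 1)‖ * (r : ℝ) ^ (n + 1)) * ‖e‖ / r := by
          rw [div_pow, pow_succ]; field_simp
      _ ≤ C * ‖e‖ / r := by gcongr; exact hpC _
  have hqs := q.hasFPowerSeriesOnBall hqrad
  refine ⟨q.sum, hqs.analyticAt, ?_⟩
  have hcont : Tendsto π (𝓝 0) (𝓝 0) := by simpa using π.continuous.tendsto 0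
  filter_upwards [Metric.eball_mem_nhds _ hp.r_pos, hcont (Metric.eball_mem_nhds _ hp.r_pos),
    Metric.eball_mem_nhds _ hqrad] with v hv1 hv2 hv3
  have h1 := (hp.hasSum hv1).sub (hp.hasSum hv2)
  have h2 := (hqs.hasSum hv3).const_smul (ℓ v)
  simp only [zero_add] at h1 h2
  simp only [← hq] at h2
  refine h1.unique ?_
  rw [← hasSum_nat_add_iff' 1]
  simpa [Subsingleton.elim (fun _ : Fin 0 => v) (fun _ => π v)] using h2

end Hadamard

/-- Hadamard division along the graph of an analytic function. -/
theorem AnalyticAt.exists_analyticAt_sub_graph_eq_mul {F : ℂ × ℂ → ℂ} {φ : ℂ → ℂ}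
    (hF : AnalyticAt ℂ F (0, 0)) (hφ : AnalyticAt ℂ φ 0) (hφ0 : φ 0 = 0) :
    ∃ q : ℂ × ℂ → ℂ, AnalyticAt ℂ q (0, 0) ∧
      ∀ᶠ z in 𝓝 ((0, 0) : ℂ × ℂ), F z - F (z.1, φ z.1) = (z.2 - φ z.1) * q z := by
  have hφ1 : AnalyticAt ℂ (fun z : ℂ × ℂ => φ z.1) (0, 0) :=
    AnalyticAt.fun_comp (g := φ) hφ analyticAt_fst
  have hG : AnalyticAt ℂ (fun z : ℂ × ℂ => F (z.1, z.2 + φ z.1)) 0 :=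
    AnalyticAt.fun_comp_of_eq hF (analyticAt_fst.prod (analyticAt_snd.add hφ1)) (by simp [hφ0])
  have hπ1 : ‖(ContinuousLinearMap.fst ℂ ℂ ℂ).prod (0 : ℂ × ℂ →L[ℂ] ℂ)‖ ≤ 1 :=
    ContinuousLinearMap.opNorm_le_bound _ zero_le_one fun z => by
      simp [Prod.norm_def]
  obtain ⟨q, hq, hGq⟩ := hG.exists_analyticAt_sub_comp_eq_smul _ hπ1
    (ContinuousLinearMap.snd ℂ ℂ ℂ) (0, 1) (fun v => by ext <;> simp)
  have hs : AnalyticAt ℂ (fun z : ℂ × ℂ => (z.1, z.2 - φ z.1)) (0, 0) :=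
    analyticAt_fst.prod (analyticAt_snd.sub hφ1)
  refine ⟨fun z => q (z.1, z.2 - φ z.1), AnalyticAt.fun_comp_of_eq hq hs (by simp [hφ0]), ?_⟩
  have ht : Tendsto (fun z : ℂ × ℂ => (z.1, z.2 - φ z.1)) (𝓝 (0, 0)) (𝓝 0) := by
    simpa [hφ0, Prod.zero_eq_mk] using hs.continuousAt.tendsto
  filter_upwards [ht.eventually hGq] with z hz
  simpa using hz

/-- An even analytic germ is an analytic function of the square. -/
theorem AnalyticAt.exists_analyticAt_comp_sq {g : ℂ → ℂ} (hg : AnalyticAt ℂ g 0)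
    (heven : ∀ᶠ s in 𝓝 0, g (-s) = g s) :
    ∃ J : ℂ → ℂ, AnalyticAt ℂ J 0 ∧ ∀ᶠ s in 𝓝 0, g s = J (s ^ 2) := by
  let σ : ℂ → ℂ := fun r => r ^ (2⁻¹ : ℂ)
  have hσ : ∀ r, σ r ^ 2 = r := fun r => by
    exact_mod_cast Complex.cpow_nat_inv_pow r (n := 2) two_ne_zero
  have hσ0 : σ 0 = 0 := by simpa using hσ 0
  have hσc : Tendsto σ (𝓝 0) (𝓝 0) := by
    have := (Complex.continuousAt_cpow_const_of_re_pos (z := 0) (w := 2⁻¹) (by simp)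
      (by norm_num)).tendsto
    simpa [σ] using this
  have hJ : ∀ᶠ s in 𝓝 0, g s = g (σ (s ^ 2)) := by
    filter_upwards [heven] with s hs
    rcases sq_eq_sq_iff_eq_or_eq_neg.1 (hσ (s ^ 2)) with h | h
    · rw [h]
    · rw [h, hs]
  refine ⟨g ∘ σ, ?_, hJ⟩
  refine Complex.analyticAt_of_differentiable_on_punctured_nhds_of_continuousAt ?_ ?_
  · filter_upwards [self_mem_nhdsWithin, nhdsWithin_le_nhds (hσc.eventually
      (hJ.eventually_nhds.and hg.eventually_analyticAt))] with r hr hr'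
    obtain ⟨h1, h2⟩ := hr'
    have hne : σ r ≠ 0 := fun h => hr (by simpa [h] using (hσ r).symm)
    have hsq : AnalyticAt ℂ (fun s : ℂ => s ^ 2) (σ r) := analyticAt_id.pow 2
    have := (analyticAt_comp_iff_of_deriv_ne_zero (g := g ∘ σ) hsq (by simpa using hne)).1
      (h2.congr h1)
    rw [hσ] at this
    exact this.differentiableAt
  · exact ContinuousAt.comp (by rw [hσ0]; exact hg.continuousAt)
      (by simpa [ContinuousAt, hσ0] using hσc)

/-- A germ invariant under an analytic involution `φ` with `φ' 0 = -1` is an analytic function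
of the invariant `h * φ h`. -/
theorem AnalyticAt.exists_analyticAt_comp_mul_involution {f φ : ℂ → ℂ} (hf : AnalyticAt ℂ f 0)
    (hφ : AnalyticAt ℂ φ 0) (hφ0 : φ 0 = 0) (hφ' : deriv φ 0 = -1)
    (hinv : ∀ᶠ h in 𝓝 0, φ (φ h) = h) (hfφ : ∀ᶠ h in 𝓝 0, f (φ h) = f h) :
    ∃ J : ℂ → ℂ, AnalyticAt ℂ J 0 ∧ ∀ᶠ h in 𝓝 0, f h = J (h * φ h) := by
  obtain ⟨p, hp⟩ := hφ
  let a : ℂ → ℂ := dslope φ 0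
  have ha : AnalyticAt ℂ a 0 := hp.has_fpower_series_dslope_fslope.analyticAt
  replace hφ : AnalyticAt ℂ φ 0 := hp.analyticAt
  have ha0 : a 0 = -1 := by simp [a, hφ']
  have hφa : ∀ h, φ h = h * a h := fun h => by
    simpa [hφ0] using (sub_smul_dslope φ 0 h).symm
  let c : ℂ → ℂ := fun h => (-a h) ^ (2⁻¹ : ℂ)
  have hc : AnalyticAt ℂ c 0 := ha.neg.cpow analyticAt_const (by simp [ha0])
  have hc0 : c 0 = 1 := by simp [c, ha0]
  have hc2 : ∀ h, c h ^ 2 = -a h := fun h => by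
    exact_mod_cast Complex.cpow_nat_inv_pow (-a h) (n := 2) two_ne_zero
  let w : ℂ → ℂ := fun h => h * c h
  have hw : AnalyticAt ℂ w 0 := analyticAt_id.mul hc
  have hw0 : w 0 = 0 := by simp [w]
  have hw2 : ∀ h, w h ^ 2 = -(h * φ h) := fun h => by
    rw [mul_pow, hc2, hφa]; ring
  have hw' : deriv w 0 ≠ 0 := by
    have : HasDerivAt w (1 * c 0 + 0 * deriv c 0) 0 :=
      (hasDerivAt_id 0).mul hc.differentiableAt.hasDerivAt
    rw [this.deriv, hc0]; simp
  have hφt : Tendsto φ (𝓝 0) (𝓝 0) := by simpa [hφ0] using hφ.continuousAt.tendsto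
  have hwφ : ∀ᶠ h in 𝓝 0, w (φ h) = -w h := by
    have hlim : Tendsto (fun h => a h * c (φ h) - c h) (𝓝 0) (𝓝 (-1 * 1 - 1)) := by
      refine Tendsto.sub (Tendsto.mul ?_ ?_) ?_
      · simpa [ha0] using ha.continuousAt.tendsto
      · exact Tendsto.comp (by simpa [hc0] using hc.continuousAt.tendsto) hφt
      · simpa [hc0] using hc.continuousAt.tendsto
    filter_upwards [hlim.eventually_ne (by norm_num : (-1 * 1 - 1 : ℂ) ≠ 0), hinv] with h h1 h2
    have h3 : w (φ h) ^ 2 = w h ^ 2 := by rw [hw2, hw2, h2]; ring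
    rcases sq_eq_sq_iff_eq_or_eq_neg.1 h3 with h4 | h4
    · have h5 : h * (a h * c (φ h) - c h) = 0 := by
        have : w (φ h) - w h = 0 := by rw [h4, sub_self]
        rw [← this]
        simp only [w]
        rw [mul_sub, ← mul_assoc, ← hφa]
      have : h = 0 := (mul_eq_zero.1 h5).resolve_right h1
      simp [this, hφ0, hw0]
    · exact h4
  let v := hw.hasStrictDerivAt.localInverse _ _ _ hw'
  have hv : AnalyticAt ℂ v 0 := by simpa [hw0] using hw.analyticAt_localInverse hw'
  have hvw : ∀ᶠ h in 𝓝 0, v (w h) = h := hw.hasStrictDerivAt.eventually_left_inverse hw'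
  have hwv : ∀ᶠ s in 𝓝 0, w (v s) = s := by
    simpa [hw0] using hw.hasStrictDerivAt.eventually_right_inverse hw'
  have hv0 : v 0 = 0 := by simpa [hw0] using hvw.self_of_nhds
  have hvt : Tendsto v (𝓝 0) (𝓝 0) := by simpa [hv0] using hv.continuousAt.tendsto
  have hwt : Tendsto w (𝓝 0) (𝓝 0) := by simpa [hw0] using hw.continuousAt.tendsto
  obtain ⟨J, hJ, hfJ⟩ := AnalyticAt.exists_analyticAt_comp_sq (g := fun s => f (v s))
    (hf.fun_comp_of_eq hv hv0) (by
      filter_upwards [hwv, hvt.eventually (hwφ.and (hfφ.and (hφt.eventually hvw)))]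
        with s h1 ⟨h2, h3, h4⟩
      rw [h2, h1] at h4
      rw [h4, h3])
  refine ⟨fun r => J (-r), hJ.fun_comp_of_eq analyticAt_id.neg (by simp), ?_⟩
  filter_upwards [hvw, hwt.eventually hfJ] with h h1 h2
  rw [h1, hw2] at h2
  exact h2

/-- A function with a simple zero along a graph is not a zero divisor among continuous germs. -/
theorem eventually_eq_zero_of_mul_eq_zero_of_graph {A D : ℂ × ℂ → ℂ} {φ : ℂ → ℂ}
    (hA : ∀ᶠ z in 𝓝 ((0, 0) : ℂ × ℂ), ContinuousAt A z)
    (hD : ∀ᶠ z in 𝓝 ((0, 0) : ℂ × ℂ), D z = 0 → φ z.1 = z.2)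
    (hAD : ∀ᶠ z in 𝓝 ((0, 0) : ℂ × ℂ), A z * D z = 0) :
    ∀ᶠ z in 𝓝 ((0, 0) : ℂ × ℂ), A z = 0 := by
  filter_upwards [hA, hD.eventually_nhds, hAD.eventually_nhds] with z h1 h2 h3
  by_contra hne
  have hgraph : ∀ᶠ y in 𝓝 z, φ y.1 = y.2 := by
    filter_upwards [h1.eventually_ne hne, h2, h3] with y h4 h5 h6
    exact h5 ((mul_eq_zero.1 h6).resolve_left h4)
  have hline : Tendsto (fun k : ℂ => (z.1, k)) (𝓝[≠] z.2) (𝓝 z) :=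
    ((Continuous.prodMk_right z.1).tendsto z.2).mono_left nhdsWithin_le_nhds
  obtain ⟨k, hk, hk'⟩ := ((hline.eventually hgraph).and self_mem_nhdsWithin).exists
  exact hk' (hk.symm.trans hgraph.self_of_nhds)

/-- The zero set of a symmetric germ with nonzero first-order part is the graph of an analytic
involution. -/
theorem AnalyticAt.exists_involution_of_symmetric {D : ℂ × ℂ → ℂ} (hD : AnalyticAt ℂ D (0, 0))
    (hDsymm : ∀ h k : ℂ, D (h, k) = D (k, h)) (hD0 : D (0, 0) = 0)
    (hDsym : fderiv ℂ D (0, 0) (1, 0) = fderiv ℂ D (0, 0) (0, 1))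
    (hDne : fderiv ℂ D (0, 0) (1, 0) ≠ 0) :
    ∃ φ : ℂ → ℂ, AnalyticAt ℂ φ 0 ∧ φ 0 = 0 ∧ deriv φ 0 = -1 ∧
      (∀ᶠ h in 𝓝 0, φ (φ h) = h) ∧ ∀ᶠ z in 𝓝 ((0, 0) : ℂ × ℂ), D z = 0 ↔ φ z.1 = z.2 := by
  have hcd : ContDiffAt ℂ ⊤ D (0, 0) := hD.contDiffAt
  have hinv : (fderiv ℂ D (0, 0) ∘L .inr ℂ ℂ ℂ).IsInvertible := by
    refine ⟨ContinuousLinearEquiv.unitsEquivAut ℂ (Units.mk0 _ (hDsym ▸ hDne)), ?_⟩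
    ext
    simp
  let φ := hcd.implicitFunction (by simp) hinv
  have hφ : AnalyticAt ℂ φ 0 := (hcd.contDiffAt_implicitFunction (by simp) hinv).analyticAt
  have hφ0 : φ 0 = 0 := hcd.implicitFunction_apply_self (by simp) hinv
  have hiff : ∀ᶠ z in 𝓝 ((0, 0) : ℂ × ℂ), D z = 0 ↔ φ z.1 = z.2 := by
    simpa [hD0] using hcd.eventually_apply_eq_iff_implicitFunction (by simp) hinv
  have hDφ : ∀ᶠ h in 𝓝 0, D (h, φ h) = 0 := by
    simpa [hD0] using hcd.eventually_apply_implicitFunction (by simp) hinv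
  refine ⟨φ, hφ, hφ0, ?_, ?_, hiff⟩
  · have h1 : HasDerivAt (fun h => (h, φ h)) (1, deriv φ 0) 0 :=
      (hasDerivAt_id 0).prodMk hφ.differentiableAt.hasDerivAt
    have h2 : HasFDerivAt D (fderiv ℂ D (0, 0)) (0, φ 0) := by
      rw [hφ0]; exact hD.differentiableAt.hasFDerivAt
    have h3 := h2.comp_hasDerivAt 0 h1
    have h4 := h3.unique ((hasDerivAt_const (0 : ℂ) (0 : ℂ)).congr_of_eventuallyEq hDφ)
    have h5 : ((1, deriv φ 0) : ℂ × ℂ) = (1, 0) + deriv φ 0 • (0, 1) := by simp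
    rw [h5, map_add, map_smul, ← hDsym, smul_eq_mul] at h4
    have h6 : fderiv ℂ D (0, 0) (1, 0) * (1 + deriv φ 0) = 0 := by linear_combination h4
    linear_combination (mul_eq_zero.1 h6).resolve_left hDne
  · have ht : Tendsto (fun h => (φ h, h)) (𝓝 0) (𝓝 (0, 0)) := by
      simpa [hφ0] using (hφ.continuousAt.prodMk continuousAt_id).tendsto
    filter_upwards [hDφ, ht.eventually hiff] with h h1 h2
    exact h2.1 ((hDsymm _ _).trans h1)

theorem stmt17 (N D : ℂ × ℂ → ℂ)
    (hN : AnalyticAt ℂ N (0,0)) (hD : AnalyticAt ℂ D (0,0))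
    (hNsymm : ∀ h k : ℂ, N (h,k) = N (k,h)) (hDsymm : ∀ h k : ℂ, D (h,k) = D (k,h))
    (hD0 : D (0,0) = 0)
    (hDsym : fderiv ℂ D (0,0) (1,0) = fderiv ℂ D (0,0) (0,1))
    (hDne : fderiv ℂ D (0,0) (1,0) ≠ 0) :
    ∃ Q : ℂ × ℂ → ℂ, ∃ J : ℂ → ℂ,
      AnalyticAt ℂ Q (0,0) ∧ AnalyticAt ℂ J 0 ∧
      (∀ᶠ z in nhds ((0,0) : ℂ × ℂ), Q (z.1, z.2) = Q (z.2, z.1)) ∧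
      (∀ᶠ z in nhds ((0,0) : ℂ × ℂ), N z = Q z * D z + J (z.1 * z.2)) ∧
      ∀ Q' : ℂ × ℂ → ℂ, ∀ J' : ℂ → ℂ,
        AnalyticAt ℂ Q' (0,0) → AnalyticAt ℂ J' 0 →
        (∀ᶠ z in nhds ((0,0) : ℂ × ℂ), Q' (z.1, z.2) = Q' (z.2, z.1)) →
        (∀ᶠ z in nhds ((0,0) : ℂ × ℂ), N z = Q' z * D z + J' (z.1 * z.2)) →
        (Q' =ᶠ[nhds ((0,0) : ℂ × ℂ)] Q ∧ J' =ᶠ[nhds (0:ℂ)] J) := by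
  obtain ⟨φ, hφ, hφ0, hφ', hinv, hiff⟩ :=
    hD.exists_involution_of_symmetric hDsymm hD0 hDsym hDne
  have hgraph : AnalyticAt ℂ (fun h => (h, φ h)) 0 := analyticAt_id.prod hφ
  have hgrapht : Tendsto (fun h => (h, φ h)) (𝓝 0) (𝓝 (0, 0)) := by
    simpa [hφ0] using hgraph.continuousAt.tendsto
  have hfst : Tendsto (Prod.fst : ℂ × ℂ → ℂ) (𝓝 (0, 0)) (𝓝 0) := continuous_fst.tendsto _
  have hDφ : ∀ᶠ h in 𝓝 0, D (h, φ h) = 0 := by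
    filter_upwards [hgrapht.eventually hiff] with h hh
    exact hh.2 rfl
  obtain ⟨J, hJ, hNJ⟩ := AnalyticAt.exists_analyticAt_comp_mul_involution
    (f := fun h => N (h, φ h)) (AnalyticAt.fun_comp_of_eq hN hgraph (by simp [hφ0])) hφ hφ0 hφ' hinv
    (by
      filter_upwards [hinv] with h hh
      rw [hh, hNsymm])
  have hmul : AnalyticAt ℂ (fun z : ℂ × ℂ => z.1 * z.2) (0, 0) :=
    analyticAt_fst.mul analyticAt_snd
  obtain ⟨q, hq, hNq⟩ := AnalyticAt.exists_analyticAt_sub_graph_eq_mul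
    (hN.sub (AnalyticAt.fun_comp_of_eq hJ hmul (by simp))) hφ hφ0
  obtain ⟨d, hd, hDd⟩ := hD.exists_analyticAt_sub_graph_eq_mul hφ hφ0
  have hd0 : d (0, 0) ≠ 0 := by
    intro h0
    have hl : HasDerivAt (fun k : ℂ => ((0 : ℂ), k)) (0, 1) 0 :=
      (hasDerivAt_const _ _).prodMk (hasDerivAt_id 0)
    have hlt : Tendsto (fun k : ℂ => ((0 : ℂ), k)) (𝓝 0) (𝓝 (0, 0)) :=
      (Continuous.prodMk_right (0 : ℂ)).tendsto 0
    have h1 := hD.differentiableAt.hasFDerivAt.comp_hasDerivAt (0 : ℂ) hl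
    have h2 := (hasDerivAt_id (0 : ℂ)).mul
      (hd.differentiableAt.hasFDerivAt.comp_hasDerivAt (0 : ℂ) hl)
    have h3 := h1.unique (h2.congr_of_eventuallyEq (by
      filter_upwards [hlt.eventually hDd] with k hk
      simpa [hφ0, hD0] using hk))
    simp only [Function.comp_apply, h0, id, mul_zero, zero_mul, add_zero] at h3
    exact hDne (hDsym.trans h3)
  let Q₀ : ℂ × ℂ → ℂ := fun z => q z / d z
  have hQ₀ : AnalyticAt ℂ Q₀ (0, 0) := hq.div hd hd0
  have hNQ₀ : ∀ᶠ z in 𝓝 ((0, 0) : ℂ × ℂ), N z = Q₀ z * D z + J (z.1 * z.2) := by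
    filter_upwards [hNq, hDd, hfst.eventually hDφ, hfst.eventually hNJ,
      hd.continuousAt.eventually_ne hd0] with z h1 h2 h3 h4 h5
    simp only [Pi.sub_apply] at h1
    rw [h4, sub_self, sub_zero] at h1
    rw [h3, sub_zero] at h2
    have : Q₀ z * D z = (z.2 - φ z.1) * q z := by
      simp only [Q₀]; rw [h2]; field_simp
    rw [this, ← h1]; ring
  let Q : ℂ × ℂ → ℂ := fun z => (Q₀ z + Q₀ (z.2, z.1)) / 2
  have hswap : AnalyticAt ℂ (fun z : ℂ × ℂ => (z.2, z.1)) (0, 0) :=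
    analyticAt_snd.prod analyticAt_fst
  have hQ : AnalyticAt ℂ Q (0, 0) :=
    (hQ₀.add (AnalyticAt.fun_comp_of_eq hQ₀ hswap rfl)).div analyticAt_const two_ne_zero
  have hNQ : ∀ᶠ z in 𝓝 ((0, 0) : ℂ × ℂ), N z = Q z * D z + J (z.1 * z.2) := by
    have hst : Tendsto (fun z : ℂ × ℂ => (z.2, z.1)) (𝓝 (0, 0)) (𝓝 (0, 0)) :=
      continuous_swap.tendsto _
    filter_upwards [hNQ₀, hst.eventually hNQ₀] with z h1 h2
    rw [hNsymm, hDsymm, mul_comm z.2] at h2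
    simp only [Q]
    linear_combination (h1 + h2) / 2
  refine ⟨Q, J, hQ, hJ, .of_forall fun z => by simp only [Q]; ring, hNQ, ?_⟩
  intro Q' J' hQ' hJ' _ hNQ'
  have hJJ : ∀ᶠ r in 𝓝 (0 : ℂ), (J' - J) r = 0 := by
    refine (hJ'.sub hJ).frequently_zero_iff_eventually_zero.1 ?_
    have hφt : Tendsto φ (𝓝 0) (𝓝 0) := by simpa [hφ0] using hφ.continuousAt.tendsto
    have ht : Tendsto (fun h => h * φ h) (𝓝[≠] 0) (𝓝[≠] 0) := by
      refine tendsto_nhdsWithin_iff.2 ⟨?_, ?_⟩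
      · simpa using (tendsto_id.mul hφt).mono_left nhdsWithin_le_nhds
      · filter_upwards [self_mem_nhdsWithin, nhdsWithin_le_nhds hinv] with h h1 h2
        refine mul_ne_zero h1 fun h3 => h1 ?_
        rw [h3, hφ0] at h2
        exact h2.symm
    refine ht.frequently (Eventually.frequently ?_)
    filter_upwards [nhdsWithin_le_nhds hDφ, nhdsWithin_le_nhds (hgrapht.eventually hNQ),
      nhdsWithin_le_nhds (hgrapht.eventually hNQ')] with h h1 h2 h3
    rw [h1, mul_zero, zero_add] at h2 h3
    rw [Pi.sub_apply, ← h2, ← h3, sub_self]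
  have hJeq : J' =ᶠ[𝓝 0] J := hJJ.mono fun r hr => sub_eq_zero.1 hr
  refine ⟨?_, hJeq⟩
  have hmult : Tendsto (fun z : ℂ × ℂ => z.1 * z.2) (𝓝 (0, 0)) (𝓝 0) := by
    simpa using hmul.continuousAt.tendsto
  have := eventually_eq_zero_of_mul_eq_zero_of_graph (A := Q' - Q)
    ((hQ'.sub hQ).eventually_analyticAt.mono fun _ h => h.continuousAt)
    (hiff.mono fun _ h => h.1) (by
      filter_upwards [hNQ, hNQ', hmult.eventually hJeq] with z h1 h2 h3
      rw [Pi.sub_apply]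
      linear_combination h1 - h2 - h3)
  exact this.mono fun z hz => sub_eq_zero.1 hz
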